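/- Let k >= 1 be an integer, ell an integer with 0 <= ell <= k, r an integer, and q real with 0 < q < 1. Then sum_{j in Z} q^{j((2k+3)j+2ell+1)/2} ( V_{r-ell-(2k+3)j}(q) - V_{r+ell+1+(2k+3)j}(q) ) = (q;q)_inf * sum_{n >= 0, n == r+ell (mod 2)} q^{n^2/2}/(q;q)_n * sum_{L >= 0} q^{(2L+r-ell)/2} / ((q;q)_L (q;q)_{L+r}) * sum_{i = 0, i == r (mod 2)}^{k} X^{(1,k+2)}_{1,i+1}(n, ell+1; q^{-1}) * X^{(1,k+2)}_{1,i+1}(2L+r, 1; q). -/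

import Mathlib

open scoped BigOperators

noncomputable section

/-- Finite q-Pochhammer symbol `(a;q)_n`. -/
def qP (q a : ℝ) (n : ℕ) : ℝ := ∏ m ∈ Finset.range n, (1 - a * q ^ m)

/-- Infinite q-Pochhammer symbol `(a;q)_∞`. -/
def qPInf (q a : ℝ) : ℝ := ∏' m : ℕ, (1 - a * q ^ m)

/-- `1/(q;q)_n` for `n : ℤ`, equal to `0` for negative `n`. -/
def invQ (q : ℝ) (n : ℤ) : ℝ := if 0 ≤ n then (qP q q n.toNat)⁻¹ else 0

/-- `C(n,2) = n(n-1)/2` for `n : ℤ` (exact integer division). -/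
def ch2 (n : ℤ) : ℤ := n * (n - 1) / 2

/-- Graded parafermion Verma character `V_t(q)`. -/
def V (q : ℝ) (t : ℤ) : ℝ :=
  (qPInf q q)⁻¹ * ∑' ij : ℕ × ℕ,
    q ^ (((ch2 (2 * (ij.2 : ℤ) - 2 * (ij.1 : ℤ) - t) + (ij.2 : ℤ) : ℤ) : ℝ)) *
      ((qP q q ij.1)⁻¹ * (qP q q ij.2)⁻¹)

/-- q-binomial coefficient `[n choose m]_q`, zero unless `0 ≤ m ≤ n`. -/
def qBinI (q : ℝ) (n m : ℤ) : ℝ :=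
  if 0 ≤ m ∧ m ≤ n then
    qP q q n.toNat * ((qP q q m.toNat)⁻¹ * (qP q q (n - m).toNat)⁻¹)
  else 0

/-- One-dimensional configuration sum `X^{(p,p')}_{r,s}(L,b;q)` of the ABF model. -/
def Xcfg (q : ℝ) (p p' r s b L : ℤ) : ℝ :=
  ∑' j : ℤ,
    (q ^ (j * (p * p' * j + p' * r - p * s)) * qBinI q L ((L + s - b) / 2 - p' * j)
      - q ^ ((p * j + r) * (p' * j + s)) * qBinI q L ((L - s - b) / 2 - p' * j))


section basics
variable {q : ℝ}

lemma qP_pos (hq0 : 0 < q) (hq1 : q < 1) (n : ℕ) : 0 < qP q q n := by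
  unfold qP
  apply Finset.prod_pos
  intro m _
  have : q * q ^ m < 1 := by
    rw [← pow_succ']
    exact pow_lt_one₀ hq0.le hq1 (by omega)
  linarith

lemma qP_succ (n : ℕ) : qP q q (n + 1) = qP q q n * (1 - q ^ (n + 1)) := by
  unfold qP
  rw [Finset.prod_range_succ, pow_succ']

lemma qP_zero : qP q q 0 = 1 := by simp [qP]

lemma qP_anti (hq0 : 0 < q) (hq1 : q < 1) : Antitone (fun n => qP q q n) := by
  apply antitone_nat_of_succ_le
  intro n
  rw [qP_succ]
  have h1 := qP_pos hq0 hq1 n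
  have : 0 < q ^ (n + 1) := by positivity
  nlinarith

lemma qP_le_one (hq0 : 0 < q) (hq1 : q < 1) (n : ℕ) : qP q q n ≤ 1 := by
  have := qP_anti hq0 hq1 (Nat.zero_le n)
  simpa [qP_zero] using this

lemma qP_summ (hq0 : 0 < q) (hq1 : q < 1) : Summable (fun m : ℕ => ‖-(q * q ^ m)‖) := by
  simp only [norm_neg]
  exact ((summable_geometric_of_lt_one hq0.le hq1).mul_left q).norm

lemma qP_tendsto (hq0 : 0 < q) (hq1 : q < 1) :
    Filter.Tendsto (fun n => qP q q n) Filter.atTop (nhds (qPInf q q)) := by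
  have h := (multipliable_one_add_of_summable (qP_summ hq0 hq1)).tendsto_prod_tprod_nat
  simpa [qP, qPInf, sub_eq_add_neg] using h

lemma qPInf_ne (hq0 : 0 < q) (hq1 : q < 1) : qPInf q q ≠ 0 := by
  have h := tprod_one_add_ne_zero_of_summable (f := fun m : ℕ => -(q * q ^ m)) (by
    intro i
    have : q * q ^ i < 1 := by
      rw [← pow_succ']
      exact pow_lt_one₀ hq0.le hq1 (by omega)
    linarith) (qP_summ hq0 hq1)
  simpa [qPInf, sub_eq_add_neg] using h

lemma qPInf_le (hq0 : 0 < q) (hq1 : q < 1) (n : ℕ) : qPInf q q ≤ qP q q n :=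
  (qP_anti hq0 hq1).le_of_tendsto (qP_tendsto hq0 hq1) n

lemma qPInf_pos (hq0 : 0 < q) (hq1 : q < 1) : 0 < qPInf q q := by
  have h : 0 ≤ qPInf q q :=
    ge_of_tendsto' (qP_tendsto hq0 hq1) (fun n => (qP_pos hq0 hq1 n).le)
  exact lt_of_le_of_ne h (qPInf_ne hq0 hq1).symm

lemma invQ_nonneg (hq0 : 0 < q) (hq1 : q < 1) (n : ℤ) : 0 ≤ invQ q n := by
  unfold invQ
  split_ifs
  · exact (inv_pos.mpr (qP_pos hq0 hq1 _)).le
  · exact le_rfl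

lemma invQ_le (hq0 : 0 < q) (hq1 : q < 1) (n : ℤ) : invQ q n ≤ (qPInf q q)⁻¹ := by
  unfold invQ
  split_ifs
  · exact inv_anti₀ (qPInf_pos hq0 hq1) (qPInf_le hq0 hq1 _)
  · exact (inv_pos.mpr (qPInf_pos hq0 hq1)).le

lemma invQ_neg {n : ℤ} (h : n < 0) : invQ q n = 0 := by
  unfold invQ; rw [if_neg (by omega)]

lemma invQ_nat (n : ℕ) : invQ q (n : ℤ) = (qP q q n)⁻¹ := by
  unfold invQ; simp

lemma invQ_zero : invQ q 0 = 1 := by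
  have := invQ_nat (q := q) 0
  simpa [qP_zero] using this

lemma invQ_rec (hq0 : 0 < q) (hq1 : q < 1) (n : ℤ) :
    invQ q n = (1 - q ^ ((n : ℝ) + 1)) * invQ q (n + 1) := by
  rcases lt_trichotomy n (-1) with h | h | h
  · rw [invQ_neg (by omega), invQ_neg (by omega), mul_zero]
  · subst h; rw [invQ_neg (by omega)]; simp
  · obtain ⟨m, rfl⟩ : ∃ m : ℕ, n = m := ⟨n.toNat, by omega⟩
    have e : ((m : ℤ) + 1) = ((m + 1 : ℕ) : ℤ) := by push_cast; ring
    rw [e, invQ_nat, invQ_nat, qP_succ]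
    have h1 := qP_pos hq0 hq1 m
    have h2 := qP_pos hq0 hq1 (m + 1)
    rw [qP_succ] at h2
    have h3 : (1 - q ^ (m + 1)) ≠ 0 := by
      intro h; rw [h] at h2; simp at h2
    have e2 : q ^ (((m : ℤ) : ℝ) + 1) = q ^ (m + 1) := by
      rw [← Real.rpow_natCast]; push_cast; rfl
    rw [e2]
    field_simp

lemma qBinI_eq (n m : ℤ) : qBinI q n m = qP q q n.toNat * (invQ q m * invQ q (n - m)) := by
  unfold qBinI
  split_ifs with h
  · unfold invQ; rw [if_pos h.1, if_pos (by omega)]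
  · by_cases h0 : 0 ≤ m
    · rw [invQ_neg (n := n - m) (by omega)]; ring
    · rw [invQ_neg (n := m) (by omega)]; ring

/-- gaussian summability -/
lemma summ_abs (hq0 : 0 < q) (hq1 : q < 1) : Summable (fun n : ℤ => q ^ (|(n : ℝ)|)) := by
  have key : Summable (fun n : ℕ => q ^ (|((n : ℤ) : ℝ)|)) := by
    have := summable_geometric_of_lt_one hq0.le hq1
    refine this.congr (fun n => ?_)
    simp
  rw [summable_int_iff_summable_nat_and_neg]
  refine ⟨key, ?_⟩
  refine key.congr (fun n => ?_)
  simp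

lemma summ_gauss (hq0 : 0 < q) (hq1 : q < 1) (α β γ : ℝ) (hα : 0 < α) :
    Summable (fun n : ℤ => q ^ (α * (n : ℝ) ^ 2 + β * n + γ)) := by
  have h := (summ_abs hq0 hq1).mul_left (q ^ (γ - (|β| + 1) ^ 2 / (4 * α)))
  refine h.of_nonneg_of_le (fun n => (Real.rpow_pos_of_pos hq0 _).le) (fun n => ?_)
  rw [← Real.rpow_add hq0]
  apply Real.rpow_le_rpow_of_exponent_ge hq0 hq1.le
  have h1 : -(|β| * |(n : ℝ)|) ≤ β * n := by
    rw [← abs_mul]; exact neg_abs_le _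
  have h2 : (n : ℝ) ^ 2 = |(n : ℝ)| ^ 2 := (sq_abs _).symm
  rw [h2]
  set x := |(n : ℝ)|
  have h3 : 0 ≤ (2 * α * x - (|β| + 1)) ^ 2 / (4 * α) := by positivity
  have h4 : (2 * α * x - (|β| + 1)) ^ 2 / (4 * α) = α * x ^ 2 - (|β| + 1) * x + (|β| + 1) ^ 2 / (4 * α) := by
    field_simp; ring
  linarith

end basics

section vander
variable {q : ℝ}

lemma hasSum_eqv {ι : Type*} {f g : ι → ℝ} {a b : ℝ} (h : HasSum f a) (h1 : ∀ x, g x = f x)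
    (h2 : b = a) : HasSum g b := by
  have : g = f := funext h1
  rw [this, h2]; exact h

def qb (q : ℝ) (n : ℕ) (m : ℤ) : ℝ := qP q q n * (invQ q m * invQ q ((n : ℤ) - m))

lemma qb_neg {n : ℕ} {m : ℤ} (h : m < 0) : qb q n m = 0 := by
  unfold qb; rw [invQ_neg h]; ring

lemma qb_gt {n : ℕ} {m : ℤ} (h : (n : ℤ) < m) : qb q n m = 0 := by
  unfold qb; rw [invQ_neg (n := (n : ℤ) - m) (by omega)]; ring

lemma qb_out {n : ℕ} {m : ℤ} (h : m ∉ Finset.Icc (0 : ℤ) n) : qb q n m = 0 := by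
  simp only [Finset.mem_Icc, not_and_or, not_le] at h
  rcases h with h | h
  · exact qb_neg h
  · exact qb_gt h

lemma qb_pascal1 (hq0 : 0 < q) (hq1 : q < 1) (n : ℕ) (k : ℤ) :
    qb q (n + 1) k = qb q n (k - 1) + q ^ (k : ℝ) * qb q n k := by
  unfold qb
  have h1 := invQ_rec hq0 hq1 (k - 1)
  have h2 := invQ_rec hq0 hq1 ((n : ℤ) - k)
  have e1 : ((n : ℤ) - (k - 1)) = (n : ℤ) - k + 1 := by ring
  have e2 : (((n + 1 : ℕ) : ℤ) - k) = (n : ℤ) - k + 1 := by push_cast; ring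
  rw [e1, e2, h1, h2, qP_succ]
  have e3 : k - 1 + 1 = k := by ring
  rw [e3]
  have e4 : q ^ (n + 1) = q ^ (k : ℝ) * q ^ ((((n : ℤ) - k : ℤ) : ℝ) + 1) := by
    rw [← Real.rpow_add hq0, ← Real.rpow_natCast]; congr 1; push_cast; ring
  have e5 : (((k - 1 : ℤ) : ℝ) + 1) = k := by push_cast; ring
  rw [e4, e5]
  ring

lemma qb_pascal2 (hq0 : 0 < q) (hq1 : q < 1) (n : ℕ) (k : ℤ) :
    qb q (n + 1) k = q ^ ((n : ℝ) + 1 - k) * qb q n (k - 1) + qb q n k := by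
  unfold qb
  have h1 := invQ_rec hq0 hq1 (k - 1)
  have h2 := invQ_rec hq0 hq1 ((n : ℤ) - k)
  have e1 : ((n : ℤ) - (k - 1)) = (n : ℤ) - k + 1 := by ring
  have e2 : (((n + 1 : ℕ) : ℤ) - k) = (n : ℤ) - k + 1 := by push_cast; ring
  rw [e1, e2, h1, h2, qP_succ]
  have e3 : k - 1 + 1 = k := by ring
  rw [e3]
  have e4 : q ^ (n + 1) = q ^ (k : ℝ) * q ^ ((n : ℝ) + 1 - k) := by
    rw [← Real.rpow_add hq0, ← Real.rpow_natCast]; congr 1; push_cast; ring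
  have e5 : (((k - 1 : ℤ) : ℝ) + 1) = k := by push_cast; ring
  have e6 : ((((n : ℤ) - k : ℤ) : ℝ) + 1) = (n : ℝ) + 1 - k := by push_cast; ring
  rw [e4, e5, e6]
  ring

lemma vandermonde (hq0 : 0 < q) (hq1 : q < 1) (N : ℕ) : ∀ (M : ℕ) (K : ℤ),
    HasSum (fun m : ℤ => q ^ (((N : ℝ) - m) * (K - m)) * (qb q N m * qb q M (K - m)))
      (qb q (N + M) K) := by
  induction N with
  | zero =>
    intro M K
    have h := hasSum_single (f := fun m : ℤ => q ^ ((((0 : ℕ) : ℝ) - m) * (K - m)) * (qb q 0 m * qb q M (K - m))) 0 (by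
      intro m hm
      have : qb q 0 m = 0 := qb_out (by simp; omega)
      simp [this])
    have e : qb q 0 0 = 1 := by simp [qb, invQ_zero, qP_zero]
    simpa [e] using h
  | succ N ih =>
    intro M K
    have h := ih (M + 1) K
    set f1 : ℤ → ℝ := fun m => q ^ (((N : ℝ) - m) * (K - m)) * (qb q N m * qb q M (K - m - 1)) with hf1
    set f2 : ℤ → ℝ := fun m => q ^ (((N : ℝ) + 1 - m) * (K - m)) * (qb q N m * qb q M (K - m)) with hf2
    have s1 : Summable f1 := summable_of_ne_finset_zero (s := Finset.Icc (0 : ℤ) N) (by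
      intro m hm; simp [hf1, qb_out hm])
    have s2 : Summable f2 := summable_of_ne_finset_zero (s := Finset.Icc (0 : ℤ) N) (by
      intro m hm; simp [hf2, qb_out hm])
    have e : (fun m : ℤ => q ^ (((N : ℝ) - m) * (K - m)) * (qb q N m * qb q (M + 1) (K - m)))
        = fun m => f1 m + f2 m := by
      funext m
      rw [qb_pascal1 hq0 hq1]
      simp only [hf1, hf2]
      have : q ^ (((N : ℝ) + 1 - m) * (K - m)) = q ^ (((N : ℝ) - m) * (K - m)) * q ^ (((K - m : ℤ)) : ℝ) := by
        rw [← Real.rpow_add hq0]; congr 1; push_cast; ring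
      rw [this]; ring
    rw [e] at h
    have hv := h.unique (s1.hasSum.add s2.hasSum)
    have h1' : HasSum (fun m : ℤ => f1 (m - 1)) (∑' m, f1 m) :=
      (Equiv.hasSum_iff (Equiv.subRight (1 : ℤ))).mpr s1.hasSum
    have h3 := s2.hasSum.add h1'
    have e2 : N + 1 + M = N + (M + 1) := by ring
    rw [e2, hv, add_comm (∑' m, f1 m)]
    refine h3.congr_fun ?_ |> id
    intro m
    rw [qb_pascal2 hq0 hq1]
    simp only [hf1, hf2]
    have e3 : K - (m - 1) - 1 = K - m := by ring
    rw [e3]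
    have e4 : q ^ (((N : ℝ) - ((m - 1 : ℤ) : ℝ)) * (K - ((m - 1 : ℤ) : ℝ)))
       = q ^ (((N : ℝ) + 1 - m) * (K - m)) * q ^ ((N : ℝ) + 1 - m) := by
      rw [← Real.rpow_add hq0]; congr 1; push_cast; ring
    rw [e4]
    push_cast
    ring

/-- quotient form of Vandermonde, valid for all integers -/
lemma vander_inv (hq0 : 0 < q) (hq1 : q < 1) (L r a : ℤ) :
    HasSum (fun m : ℤ => q ^ (((L : ℝ) - m) * (L + a - m)) *
        ((invQ q m * invQ q (m + (r - a))) * (invQ q (L - m) * invQ q (L - m + a))))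
      ((invQ q L * invQ q (L + r)) * (qP q q (2 * L + r).toNat * (invQ q (L + a) * invQ q (L + r - a)))) := by
  by_cases hL : L < 0
  · rw [invQ_neg hL]
    simp only [zero_mul]
    convert hasSum_zero using 1
    funext m
    by_cases hm : m < 0
    · rw [invQ_neg hm]; ring
    · rw [invQ_neg (n := L - m) (by omega)]; ring
  by_cases hL2 : L + r < 0
  · rw [invQ_neg hL2]
    simp only [zero_mul, mul_zero]
    convert hasSum_zero using 1
    funext m
    by_cases hm : m + (r - a) < 0
    · rw [invQ_neg hm]; ring
    · rw [invQ_neg (n := L - m + a) (by omega)]; ring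
  obtain ⟨N, rfl⟩ : ∃ N : ℕ, L = N := ⟨L.toNat, by omega⟩
  obtain ⟨M, hM⟩ : ∃ M : ℕ, (N : ℤ) + r = M := ⟨((N : ℤ) + r).toNat, by omega⟩
  obtain rfl : r = M - N := by omega
  have h := vandermonde hq0 hq1 N M (N + a)
  have h2 := h.mul_left (invQ q N * invQ q M)
  have e1 : (2 * (N : ℤ) + (M - N)).toNat = N + M := by omega
  rw [e1]
  have e2 : (N : ℤ) + (M - N) = M := by ring
  rw [e2]
  refine hasSum_eqv h2 (fun m => ?_) ?_
  · unfold qb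
    rw [invQ_nat, invQ_nat]
    have e3 : (M : ℤ) - (N + a - m) = m + (M - N - a) := by ring
    have e4 : (N : ℤ) + a - m = N - m + a := by ring
    rw [e3, e4]
    have p1 := (qP_pos hq0 hq1 N).ne'
    have p2 := (qP_pos hq0 hq1 M).ne'
    push_cast
    field_simp
  · unfold qb
    have e3 : ((N + M : ℕ) : ℤ) - (N + a) = M - a := by push_cast; ring
    rw [e3]

end vander

section BC
variable {q : ℝ}

def Bt (q : ℝ) (e i : ℤ) : ℝ := q ^ (i : ℝ) * (invQ q i * invQ q (i + e))
def Ct (q : ℝ) (e p : ℤ) : ℝ := q ^ ((p : ℝ) ^ 2 + e * p + p) * (invQ q p * invQ q (p + e))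
def St (q : ℝ) (e p : ℤ) : ℝ := q ^ ((p : ℝ) ^ 2 + e * p) * (invQ q p * invQ q (p + e))
def Bf (q : ℝ) (e : ℤ) : ℝ := ∑' i : ℤ, Bt q e i
def Cf (q : ℝ) (e : ℤ) : ℝ := ∑' i : ℤ, Ct q e i

lemma II_nonneg (hq0 : 0 < q) (hq1 : q < 1) (a b : ℤ) : 0 ≤ invQ q a * invQ q b :=
  mul_nonneg (invQ_nonneg hq0 hq1 _) (invQ_nonneg hq0 hq1 _)

lemma II_le (hq0 : 0 < q) (hq1 : q < 1) (a b : ℤ) :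
    invQ q a * invQ q b ≤ (qPInf q q)⁻¹ * (qPInf q q)⁻¹ :=
  mul_le_mul (invQ_le hq0 hq1 _) (invQ_le hq0 hq1 _) (invQ_nonneg hq0 hq1 _)
    (inv_pos.mpr (qPInf_pos hq0 hq1)).le

lemma Bt_nonneg (hq0 : 0 < q) (hq1 : q < 1) (e i : ℤ) : 0 ≤ Bt q e i :=
  mul_nonneg (Real.rpow_pos_of_pos hq0 _).le (II_nonneg hq0 hq1 _ _)

lemma Ct_nonneg (hq0 : 0 < q) (hq1 : q < 1) (e i : ℤ) : 0 ≤ Ct q e i :=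
  mul_nonneg (Real.rpow_pos_of_pos hq0 _).le (II_nonneg hq0 hq1 _ _)

def cbd (q : ℝ) : ℝ := (qPInf q q)⁻¹ * (qPInf q q)⁻¹

lemma cbd_pos (hq0 : 0 < q) (hq1 : q < 1) : 0 < cbd q := by
  have := qPInf_pos hq0 hq1
  unfold cbd; positivity

lemma Bt_le (hq0 : 0 < q) (hq1 : q < 1) (e i : ℤ) : Bt q e i ≤ q ^ (|(i : ℝ)|) * cbd q := by
  unfold Bt
  by_cases hi : i < 0
  · rw [invQ_neg hi]
    have := cbd_pos hq0 hq1
    simp only [zero_mul, mul_zero]; positivity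
  · have : |(i : ℝ)| = i := abs_of_nonneg (by exact_mod_cast not_lt.mp hi)
    rw [this]
    exact mul_le_mul_of_nonneg_left (II_le hq0 hq1 _ _) (Real.rpow_pos_of_pos hq0 _).le

lemma Ct_le (hq0 : 0 < q) (hq1 : q < 1) (e i : ℤ) : Ct q e i ≤ q ^ (|(i : ℝ)|) * cbd q := by
  unfold Ct
  have hc := cbd_pos hq0 hq1
  by_cases hi : i < 0
  · rw [invQ_neg hi]
    simp only [zero_mul, mul_zero]; positivity
  by_cases hj : i + e < 0
  · rw [invQ_neg hj]
    simp only [mul_zero]; positivity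
  · have h0 : (0 : ℝ) ≤ i := by exact_mod_cast not_lt.mp hi
    have h1 : (0 : ℝ) ≤ (i : ℝ) + e := by exact_mod_cast not_lt.mp hj
    rw [abs_of_nonneg h0]
    refine mul_le_mul ?_ (II_le hq0 hq1 _ _) (II_nonneg hq0 hq1 _ _) (Real.rpow_pos_of_pos hq0 _).le
    apply Real.rpow_le_rpow_of_exponent_ge hq0 hq1.le
    nlinarith

lemma Bt_summable (hq0 : 0 < q) (hq1 : q < 1) (e : ℤ) : Summable (Bt q e) :=
  ((summ_abs hq0 hq1).mul_right (cbd q)).of_nonneg_of_le (Bt_nonneg hq0 hq1 e) (Bt_le hq0 hq1 e)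

lemma Ct_summable (hq0 : 0 < q) (hq1 : q < 1) (e : ℤ) : Summable (Ct q e) :=
  ((summ_abs hq0 hq1).mul_right (cbd q)).of_nonneg_of_le (Ct_nonneg hq0 hq1 e) (Ct_le hq0 hq1 e)

def Mbd (q : ℝ) : ℝ := ∑' i : ℤ, q ^ (|(i : ℝ)|) * cbd q

lemma Cf_le (hq0 : 0 < q) (hq1 : q < 1) (e : ℤ) : Cf q e ≤ Mbd q :=
  (Ct_summable hq0 hq1 e).tsum_le_tsum (Ct_le hq0 hq1 e) ((summ_abs hq0 hq1).mul_right (cbd q))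

lemma Bf_le (hq0 : 0 < q) (hq1 : q < 1) (e : ℤ) : Bf q e ≤ Mbd q :=
  (Bt_summable hq0 hq1 e).tsum_le_tsum (Bt_le hq0 hq1 e) ((summ_abs hq0 hq1).mul_right (cbd q))

lemma Cf_nonneg (hq0 : 0 < q) (hq1 : q < 1) (e : ℤ) : 0 ≤ Cf q e :=
  tsum_nonneg (Ct_nonneg hq0 hq1 e)

lemma Bf_nonneg (hq0 : 0 < q) (hq1 : q < 1) (e : ℤ) : 0 ≤ Bf q e :=
  tsum_nonneg (Bt_nonneg hq0 hq1 e)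

def Sf (q : ℝ) (e : ℤ) : ℝ := Cf q e + q ^ ((e : ℝ) + 1) * Cf q (e + 1)

lemma St_hasSum (hq0 : 0 < q) (hq1 : q < 1) (e : ℤ) : HasSum (St q e) (Sf q e) := by
  have h1 := (Ct_summable hq0 hq1 e).hasSum
  have h2 := (Ct_summable hq0 hq1 (e + 1)).hasSum
  have h3 : HasSum (fun p : ℤ => Ct q (e + 1) (p - 1)) (Cf q (e + 1)) :=
    (Equiv.hasSum_iff (Equiv.subRight (1 : ℤ))).mpr h2
  refine hasSum_eqv (h1.add (h3.mul_left (q ^ ((e : ℝ) + 1)))) (fun p => ?_) rfl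
  unfold St Ct
  have r1 := invQ_rec hq0 hq1 (p - 1)
  have e1 : p - 1 + 1 = p := by ring
  have e2 : p - 1 + (e + 1) = p + e := by ring
  have e3 : (((p - 1 : ℤ) : ℝ) + 1) = p := by push_cast; ring
  rw [e1, e3] at r1
  rw [e2, r1]
  have e4 : q ^ ((p : ℝ) ^ 2 + e * p + p) = q ^ ((p : ℝ) ^ 2 + e * p) * q ^ (p : ℝ) := by
    rw [← Real.rpow_add hq0]
  have e5 : q ^ ((e : ℝ) + 1) * (q ^ ((((p - 1 : ℤ) : ℝ)) ^ 2 + ((e + 1 : ℤ) : ℝ) * ((p - 1 : ℤ) : ℝ) + ((p - 1 : ℤ) : ℝ)) * ((1 - q ^ (p : ℝ)) * invQ q p * invQ q (p + e))) = q ^ ((p : ℝ) ^ 2 + e * p) * ((1 - q ^ (p : ℝ)) * invQ q p * invQ q (p + e)) := by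
    rw [← mul_assoc, ← Real.rpow_add hq0]; congr 2; push_cast; ring
  rw [e4, e5]
  ring

lemma Sf_rec (hq0 : 0 < q) (hq1 : q < 1) (d : ℤ) :
    Sf q d - Sf q (d + 1) = q ^ ((d : ℝ) + 1) * (Sf q (d + 2) - Sf q (d + 1)) := by
  have h0 := St_hasSum hq0 hq1 d
  have h1 := St_hasSum hq0 hq1 (d + 1)
  have h2 : HasSum (fun p : ℤ => St q (d + 2) (p - 1)) (Sf q (d + 2)) :=
    (Equiv.hasSum_iff (Equiv.subRight (1 : ℤ))).mpr (St_hasSum hq0 hq1 (d + 2))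
  have hl := h0.sub h1
  have hr := (h2.sub h1).mul_left (q ^ ((d : ℝ) + 1))
  refine hl.unique (hasSum_eqv hr (fun m => ?_) rfl)
  unfold St
  have r1 := invQ_rec hq0 hq1 (m - 1)
  have e1 : m - 1 + 1 = m := by ring
  have e3 : (((m - 1 : ℤ) : ℝ) + 1) = m := by push_cast; ring
  rw [e1, e3] at r1
  have r2 := invQ_rec hq0 hq1 (m + d)
  have e4 : m - 1 + (d + 2) = m + d + 1 := by ring
  have e5 : m + (d + 1) = m + d + 1 := by ring
  have e6 : (((m + d : ℤ) : ℝ) + 1) = m + (d + 1) := by push_cast; ring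
  rw [e6] at r2
  rw [e4, e5, r1, r2]
  have f1 : q ^ ((m : ℝ) ^ 2 + ((d + 1 : ℤ) : ℝ) * m) = q ^ ((m : ℝ) ^ 2 + d * m) * q ^ (m : ℝ) := by
    rw [← Real.rpow_add hq0]; congr 1; push_cast; ring
  have f2 : q ^ ((((m - 1 : ℤ) : ℝ)) ^ 2 + ((d + 2 : ℤ) : ℝ) * ((m - 1 : ℤ) : ℝ)) * q ^ ((d : ℝ) + 1) = q ^ ((m : ℝ) ^ 2 + d * m) := by
    rw [← Real.rpow_add hq0]; congr 1; push_cast; ring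
  have f3 : q ^ ((m : ℝ) + (d + 1)) = q ^ (m : ℝ) * q ^ ((d : ℝ) + 1) := by
    rw [← Real.rpow_add hq0]
  rw [f1, f3, mul_sub (q ^ ((d : ℝ) + 1)), ← mul_assoc (q ^ ((d : ℝ) + 1)), mul_comm (q ^ ((d : ℝ) + 1)) (q ^ ((((m - 1 : ℤ) : ℝ)) ^ 2 + ((d + 2 : ℤ) : ℝ) * ((m - 1 : ℤ) : ℝ))), f2]
  ring

lemma Sf_abs (hq0 : 0 < q) (hq1 : q < 1) (d : ℤ) (hd : 0 ≤ d) : |Sf q d| ≤ 2 * Mbd q := by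
  unfold Sf
  have h1 := Cf_nonneg hq0 hq1 d
  have h2 := Cf_nonneg hq0 hq1 (d + 1)
  have h3 := Cf_le hq0 hq1 d
  have h4 := Cf_le hq0 hq1 (d + 1)
  have h5 : q ^ ((d : ℝ) + 1) ≤ 1 := Real.rpow_le_one hq0.le hq1.le (by
    have : (0 : ℝ) ≤ d := by exact_mod_cast hd
    linarith)
  have h6 : 0 < q ^ ((d : ℝ) + 1) := Real.rpow_pos_of_pos hq0 _
  rw [abs_of_nonneg (by positivity)]
  nlinarith

lemma Sf_const_pos (hq0 : 0 < q) (hq1 : q < 1) (d : ℤ) (hd : 0 ≤ d) : Sf q d = Sf q (d + 1) := by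
  have key : ∀ n : ℕ, ∀ d : ℤ, 0 ≤ d → |Sf q d - Sf q (d + 1)| ≤ q ^ n * (4 * Mbd q) := by
    intro n
    induction n with
    | zero =>
      intro d hd
      have h1 := Sf_abs hq0 hq1 d hd
      have h2 := Sf_abs hq0 hq1 (d + 1) (by omega)
      have := abs_sub (Sf q d) (Sf q (d + 1))
      simp; linarith
    | succ n ih =>
      intro d hd
      rw [Sf_rec hq0 hq1, abs_mul, abs_sub_comm]
      have h := ih (d + 1) (by omega)
      have e : d + 1 + 1 = d + 2 := by ring
      rw [e] at h
      have h5 : q ^ ((d : ℝ) + 1) ≤ q := by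
        conv_rhs => rw [← Real.rpow_one q]
        apply Real.rpow_le_rpow_of_exponent_ge hq0 hq1.le
        have : (0 : ℝ) ≤ d := by exact_mod_cast hd
        linarith
      have h6 : 0 < q ^ ((d : ℝ) + 1) := Real.rpow_pos_of_pos hq0 _
      rw [abs_of_pos h6, pow_succ', mul_assoc]
      exact mul_le_mul h5 h (abs_nonneg _) hq0.le
  have lim : Filter.Tendsto (fun n : ℕ => q ^ n * (4 * Mbd q)) Filter.atTop (nhds 0) := by
    have := (tendsto_pow_atTop_nhds_zero_of_lt_one hq0.le hq1).mul_const (4 * Mbd q)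
    simpa using this
  have h0 : |Sf q d - Sf q (d + 1)| ≤ 0 := ge_of_tendsto' lim (fun n => key n d hd)
  have := abs_nonpos_iff.mp h0
  linarith

lemma Sf_nat (hq0 : 0 < q) (hq1 : q < 1) (n : ℕ) : Sf q n = Sf q 0 := by
  induction n with
  | zero => simp
  | succ n ih =>
    rw [← ih, Sf_const_pos hq0 hq1 n (by omega)]; push_cast; rfl

lemma Sf_neg (hq0 : 0 < q) (hq1 : q < 1) (n : ℕ) :
    Sf q (-(n : ℤ)) = Sf q 0 ∧ Sf q (-(n : ℤ) + 1) = Sf q 0 := by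
  induction n with
  | zero =>
    have := Sf_nat hq0 hq1 1
    simpa using this
  | succ n ih =>
    have h := Sf_rec hq0 hq1 (-((n + 1 : ℕ) : ℤ))
    have e1 : (-((n + 1 : ℕ) : ℤ) + 1) = -(n : ℤ) := by push_cast; ring
    have e2 : (-((n + 1 : ℕ) : ℤ) + 2) = -(n : ℤ) + 1 := by push_cast; ring
    rw [e1, e2, ih.1, ih.2] at h
    rw [e1]
    refine ⟨?_, ih.1⟩
    have h' : Sf q (-((n + 1 : ℕ) : ℤ)) - Sf q 0 = 0 := by rw [h]; ring
    linarith

lemma Sf_all (hq0 : 0 < q) (hq1 : q < 1) (d : ℤ) : Sf q d = Sf q 0 := by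
  rcases le_total 0 d with h | h
  · obtain ⟨n, rfl⟩ : ∃ n : ℕ, d = n := ⟨d.toNat, by omega⟩
    exact Sf_nat hq0 hq1 n
  · obtain ⟨n, rfl⟩ : ∃ n : ℕ, d = -(n : ℤ) := ⟨(-d).toNat, by omega⟩
    exact (Sf_neg hq0 hq1 n).1

lemma Sf_eq (hq0 : 0 < q) (hq1 : q < 1) (d : ℤ) : Sf q d = (qPInf q q)⁻¹ := by
  rw [Sf_all hq0 hq1]
  have hp : Filter.Tendsto (fun n : ℕ => q ^ n) Filter.atTop (nhds 0) :=
    tendsto_pow_atTop_nhds_zero_of_lt_one hq0.le hq1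
  have hinv : Filter.Tendsto (fun n : ℕ => invQ q (n : ℤ)) Filter.atTop (nhds (qPInf q q)⁻¹) := by
    simp only [invQ_nat]
    exact (qP_tendsto hq0 hq1).inv₀ (qPInf_ne hq0 hq1)
  have hC : Filter.Tendsto (fun n : ℕ => Cf q n) Filter.atTop (nhds (∑' p : ℤ, if p = 0 then (qPInf q q)⁻¹ else 0)) := by
    apply tendsto_tsum_of_dominated_convergence (bound := fun i : ℤ => q ^ (|(i : ℝ)|) * cbd q)
      ((summ_abs hq0 hq1).mul_right (cbd q))
    · intro p
      split_ifs with h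
      · subst h
        refine hinv.congr (fun n => ?_)
        simp [Ct, invQ_zero]
      · rcases lt_or_gt_of_ne h with h | h
        · have : ∀ n : ℕ, Ct q n p = 0 := by
            intro n; unfold Ct; rw [invQ_neg h]; ring
          simp [this]
        · have hb : Filter.Tendsto (fun n : ℕ => q ^ n * cbd q) Filter.atTop (nhds 0) := by
            simpa using hp.mul_const (cbd q)
          refine squeeze_zero (fun n => Ct_nonneg hq0 hq1 _ _) (fun n => ?_) hb
          unfold Ct
          refine mul_le_mul ?_ (II_le hq0 hq1 _ _) (II_nonneg hq0 hq1 _ _) (by positivity)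
          rw [← Real.rpow_natCast q n]
          apply Real.rpow_le_rpow_of_exponent_ge hq0 hq1.le
          have h1 : (1 : ℝ) ≤ p := by exact_mod_cast h
          have h2 : (0 : ℝ) ≤ n := by positivity
          push_cast
          nlinarith
    · refine Filter.Eventually.of_forall (fun n p => ?_)
      rw [Real.norm_of_nonneg (Ct_nonneg hq0 hq1 _ _)]
      exact Ct_le hq0 hq1 _ _
  rw [tsum_ite_eq] at hC
  have hC1 : Filter.Tendsto (fun n : ℕ => q ^ (n + 1) * Cf q ((n : ℤ) + 1)) Filter.atTop (nhds 0) := by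
    have h1 := (hp.mul hC).comp (Filter.tendsto_add_atTop_nat 1)
    simp only [zero_mul] at h1
    refine h1.congr (fun n => ?_)
    simp
  have h := hC.add hC1
  have h2 : (fun n : ℕ => Cf q n + q ^ (n + 1) * Cf q ((n : ℤ) + 1)) = fun _ => Sf q 0 := by
    funext n
    rw [← Sf_nat hq0 hq1 n]
    unfold Sf
    congr 2
    rw [← Real.rpow_natCast]; push_cast; rfl
  rw [h2] at h
  have := tendsto_nhds_unique tendsto_const_nhds h
  simpa using this

lemma Cf_rec (hq0 : 0 < q) (hq1 : q < 1) (e : ℤ) :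
    Cf q e = (qPInf q q)⁻¹ - q ^ ((e : ℝ) + 1) * Cf q (e + 1) := by
  rw [← Sf_eq hq0 hq1 e]; unfold Sf; ring

def Dt (q : ℝ) (r a L : ℤ) : ℝ :=
  q ^ (L : ℝ) * ((invQ q L * invQ q (L + r)) * (qP q q (2 * L + r).toNat * (invQ q (L + a) * invQ q (L + r - a))))

lemma Dt_symm (r a L : ℤ) : Dt q r (r - a) L = Dt q r a L := by
  unfold Dt
  have e1 : L + (r - a) = L + r - a := by ring
  have e2 : L + r - (r - a) = L + a := by ring
  rw [e1, e2]; ring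

lemma Dt_hasSum (hq0 : 0 < q) (hq1 : q < 1) (r a : ℤ) :
    HasSum (Dt q r a) (Bf q (r - a) * Cf q a) := by
  have hs := (Bt_summable hq0 hq1 (r - a)).mul_of_nonneg (Ct_summable hq0 hq1 a)
    (Bt_nonneg hq0 hq1 _) (Ct_nonneg hq0 hq1 _)
  have h := (Bt_summable hq0 hq1 (r - a)).hasSum.mul (Ct_summable hq0 hq1 a).hasSum hs
  let E : ℤ × ℤ ≃ ℤ × ℤ :=
    { toFun := fun x => (x.2, x.1 - x.2)
      invFun := fun y => (y.1 + y.2, y.1)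
      left_inv := by intro x; ext <;> simp
      right_inv := by intro x; ext <;> simp }
  have h2 := (Equiv.hasSum_iff E).mpr h
  refine h2.prod_fiberwise (fun L => ?_)
  have hv := (vander_inv hq0 hq1 L r a).mul_left (q ^ (L : ℝ))
  refine hasSum_eqv hv (fun m => ?_) rfl
  simp only [E, Function.comp, Equiv.coe_fn_mk, Bt, Ct]
  have e1 : q ^ (m : ℝ) * q ^ ((((L - m : ℤ) : ℝ)) ^ 2 + a * ((L - m : ℤ) : ℝ) + ((L - m : ℤ) : ℝ))
      = q ^ (L : ℝ) * q ^ (((L : ℝ) - m) * (L + a - m)) := by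
    rw [← Real.rpow_add hq0, ← Real.rpow_add hq0]; congr 1; push_cast; ring
  calc _ = (q ^ (m : ℝ) * q ^ ((((L - m : ℤ) : ℝ)) ^ 2 + a * ((L - m : ℤ) : ℝ) + ((L - m : ℤ) : ℝ))) *
        ((invQ q m * invQ q (m + (r - a))) * (invQ q (L - m) * invQ q (L - m + a))) := by ring
    _ = _ := by rw [e1]; ring

lemma BC_symm (hq0 : 0 < q) (hq1 : q < 1) (u v : ℤ) : Bf q u * Cf q v = Bf q v * Cf q u := by
  have h1 := Dt_hasSum hq0 hq1 (u + v) v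
  have h2 := Dt_hasSum hq0 hq1 (u + v) u
  have e1 : u + v - v = u := by ring
  have e2 : u + v - u = v := by ring
  rw [e1] at h1
  rw [e2] at h2
  refine h1.unique (hasSum_eqv h2 (fun L => ?_) rfl)
  have := Dt_symm (q := q) (u + v) u L
  rw [e2] at this
  exact this

/-- the key sum -/
lemma key_hasSum (hq0 : 0 < q) (hq1 : q < 1) (r a : ℤ) :
    HasSum (fun L => Dt q r a L - q ^ ((2 * a + 1 - r : ℝ)) * Dt q r (a + 1) L)
      ((Bf q (r - a) - q ^ ((2 * a + 1 - r : ℝ)) * Bf q (a + 1)) * (qPInf q q)⁻¹) := by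
  have h1 := Dt_hasSum hq0 hq1 r a
  have h2 := (Dt_hasSum hq0 hq1 r (a + 1)).mul_left (q ^ ((2 * a + 1 - r : ℝ)))
  refine hasSum_eqv (h1.sub h2) (fun _ => rfl) ?_
  rw [BC_symm hq0 hq1 (r - (a + 1)) (a + 1), Cf_rec hq0 hq1 a, Cf_rec hq0 hq1 (r - (a + 1))]
  have e1 : r - (a + 1) + 1 = r - a := by ring
  have hs := BC_symm hq0 hq1 (r - a) (a + 1)
  have e2 : q ^ ((2 * a + 1 - r : ℝ)) * q ^ (((r - (a + 1) : ℤ) : ℝ) + 1) = q ^ ((a : ℝ) + 1) := by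
    rw [← Real.rpow_add hq0]; congr 1; push_cast; ring
  rw [e1]
  linear_combination q ^ ((a : ℝ) + 1) * hs - Bf q (a + 1) * Cf q (r - a) * e2
end BC

section XX
variable {q : ℝ}

lemma qP_inv (hq0 : 0 < q) (n : ℕ) :
    qP q⁻¹ q⁻¹ n = (-1) ^ n * q ^ (-((n : ℝ) * (n + 1) / 2)) * qP q q n := by
  induction n with
  | zero => simp [qP]
  | succ n ih =>
    rw [qP_succ, qP_succ, ih]
    have e1 : q ^ (-(((n + 1 : ℕ) : ℝ) * (((n + 1 : ℕ) : ℝ) + 1) / 2)) =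
        q ^ (-((n : ℝ) * (n + 1) / 2)) * (q⁻¹) ^ (n + 1) := by
      rw [inv_pow, ← Real.rpow_natCast q, ← Real.rpow_neg hq0.le, ← Real.rpow_add hq0]
      congr 1; push_cast; ring
    rw [e1]
    have e2 : (q⁻¹) ^ (n + 1) * q ^ (n + 1) = 1 := by
      rw [← mul_pow, inv_mul_cancel₀ hq0.ne', one_pow]
    generalize (q⁻¹) ^ (n + 1) = x at *
    generalize q ^ (n + 1) = y at *
    generalize q ^ (-((n : ℝ) * (n + 1) / 2)) = z
    rw [pow_succ]
    linear_combination (-1 : ℝ) ^ n * z * qP q q n * (-1) * e2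

lemma qBinI_inv (hq0 : 0 < q) (n m : ℤ) :
    qBinI q⁻¹ n m = q ^ (-((m : ℝ) * (n - m))) * qBinI q n m := by
  unfold qBinI
  split_ifs with h
  · obtain ⟨M, rfl⟩ : ∃ M : ℕ, m = M := ⟨m.toNat, by omega⟩
    obtain ⟨K, hK⟩ : ∃ K : ℕ, n = M + K := ⟨(n - M).toNat, by omega⟩
    subst hK
    have e1 : ((M : ℤ) + K).toNat = M + K := by omega
    have e2 : ((M : ℤ) + K - M).toNat = K := by omega
    rw [e1, e2, Int.toNat_natCast, qP_inv hq0, qP_inv hq0, qP_inv hq0]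
    simp only [mul_inv]
    rw [← Real.rpow_neg hq0.le, ← Real.rpow_neg hq0.le]
    have e3 : q ^ (-(((M + K : ℕ) : ℝ) * (((M + K : ℕ) : ℝ) + 1) / 2)) *
        q ^ (-(-((M : ℝ) * (M + 1) / 2))) * q ^ (-(-((K : ℝ) * (K + 1) / 2)))
        = q ^ (-((((M : ℤ) : ℝ)) * (((((M : ℤ) + K : ℤ)) : ℝ) - ((M : ℤ) : ℝ)))) := by
      rw [← Real.rpow_add hq0, ← Real.rpow_add hq0]
      congr 1; push_cast; ring
    rw [← e3]
    have e4 : ((-1 : ℝ) ^ (M + K)) * ((-1 : ℝ) ^ M)⁻¹ * ((-1 : ℝ) ^ K)⁻¹ = 1 := by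
      rw [pow_add]; field_simp
    generalize ((-1 : ℝ) ^ M)⁻¹ = x at *
    generalize ((-1 : ℝ) ^ K)⁻¹ = y at *
    generalize (-1 : ℝ) ^ (M + K) = z at *
    generalize q ^ (-(((M + K : ℕ) : ℝ) * (((M + K : ℕ) : ℝ) + 1) / 2)) = u
    generalize q ^ (-(-((M : ℝ) * (M + 1) / 2))) = v
    generalize q ^ (-(-((K : ℝ) * (K + 1) / 2))) = w
    linear_combination u * v * w * qP q q (M + K) * (qP q q M)⁻¹ * (qP q q K)⁻¹ * e4
  · simp

def At (q : ℝ) (d n : ℤ) : ℝ :=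
  if (2 : ℤ) ∣ n - d then q ^ ((n : ℝ) ^ 2 / 2) * invQ q n * qBinI q⁻¹ n ((n + d) / 2) else 0

lemma At_hasSum_int (hq0 : 0 < q) (hq1 : q < 1) (d : ℤ) :
    HasSum (At q d) (q ^ ((d : ℝ) ^ 2 / 2) * (qPInf q q)⁻¹) := by
  have h := (St_hasSum hq0 hq1 d).mul_left (q ^ ((d : ℝ) ^ 2 / 2))
  rw [Sf_eq hq0 hq1] at h
  have hinj : Function.Injective (fun p : ℤ => 2 * p + d) := by
    intro x y hxy; simp only at hxy; omega
  refine (hinj.hasSum_iff ?_).mp (hasSum_eqv h (fun p => ?_) rfl)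
  · intro n hn
    unfold At
    rw [if_neg]
    rintro ⟨c, hc⟩
    exact hn ⟨c, by simp only; omega⟩
  · simp only [Function.comp, At]
    rw [if_pos ⟨p, by ring⟩]
    have e1 : (2 * p + d + d) / 2 = p + d := by omega
    rw [e1, qBinI_inv hq0, qBinI_eq]
    have e2 : 2 * p + d - (p + d) = p := by ring
    rw [e2]
    unfold St
    by_cases hn : 2 * p + d < 0
    · rw [invQ_neg hn]
      by_cases hp : p < 0
      · rw [invQ_neg hp]; ring
      · rw [invQ_neg (n := p + d) (by omega)]; ring
    · have e3 : invQ q (2 * p + d) * qP q q (2 * p + d).toNat = 1 := by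
        unfold invQ
        rw [if_pos (by omega)]
        exact inv_mul_cancel₀ (qP_pos hq0 hq1 _).ne'
      have e4 : q ^ ((((2 * p + d : ℤ)) : ℝ) ^ 2 / 2) * q ^ (-((((p + d : ℤ)) : ℝ) * ((((2 * p + d : ℤ)) : ℝ) - ((p + d : ℤ) : ℝ))))
         = q ^ ((d : ℝ) ^ 2 / 2) * q ^ ((p : ℝ) ^ 2 + d * p) := by
        rw [← Real.rpow_add hq0, ← Real.rpow_add hq0]; congr 1; push_cast; ring
      generalize q ^ ((((2 * p + d : ℤ)) : ℝ) ^ 2 / 2) = x at *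
      generalize q ^ (-((((p + d : ℤ)) : ℝ) * ((((2 * p + d : ℤ)) : ℝ) - ((p + d : ℤ) : ℝ)))) = y at *
      generalize invQ q (2 * p + d) = z at *
      generalize qP q q (2 * p + d).toNat = w at *
      linear_combination (x * y * invQ q p * invQ q (p + d)) * e3 + invQ q p * invQ q (p + d) * e4

lemma At_hasSum (hq0 : 0 < q) (hq1 : q < 1) (d : ℤ) :
    HasSum (fun n : ℕ => At q d n) (q ^ ((d : ℝ) ^ 2 / 2) * (qPInf q q)⁻¹) := by
  have hz : ∀ n : ℤ, n ∉ Set.range (fun n : ℕ => (n : ℤ)) → At q d n = 0 := by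
    intro n hn
    have hneg : n < 0 := by
      by_contra h
      exact hn ⟨n.toNat, Int.toNat_of_nonneg (not_lt.mp h)⟩
    unfold At
    rw [invQ_neg hneg, mul_zero, zero_mul, ite_self]
  have hinj : Function.Injective (fun n : ℕ => (n : ℤ)) := fun x y h => Int.ofNat_inj.mp h
  have key := (Function.Injective.hasSum_iff (f := At q d) hinj hz).mpr (At_hasSum_int hq0 hq1 d)
  exact key

lemma qBinI_nonneg (hq0 : 0 < q) (hq1 : q < 1) (n m : ℤ) : 0 ≤ qBinI q n m := by
  rw [qBinI_eq]
  exact mul_nonneg (qP_pos hq0 hq1 _).le (II_nonneg hq0 hq1 _ _)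

lemma At_nonneg (hq0 : 0 < q) (hq1 : q < 1) (d n : ℤ) : 0 ≤ At q d n := by
  unfold At
  split_ifs
  · rw [qBinI_inv hq0]
    have := qBinI_nonneg hq0 hq1 n ((n + d) / 2)
    have := invQ_nonneg hq0 hq1 n
    positivity
  · exact le_rfl

variable {Q : ℝ}

lemma fin_summ (c : ℤ → ℝ) (n u P : ℤ) (hP : 0 < P) :
    Summable (fun j : ℤ => c j * qBinI Q n (u - P * j)) := by
  apply summable_of_hasFiniteSupport
  have hinj : Function.Injective (fun j : ℤ => u - P * j) := by
    intro x y hxy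
    have : P * x = P * y := by simp only at hxy; omega
    exact mul_left_cancel₀ hP.ne' this
  refine ((Set.finite_Icc (0 : ℤ) n).preimage hinj.injOn).subset ?_
  intro j hj
  simp only [Function.mem_support] at hj
  simp only [Set.mem_preimage, Set.mem_Icc]
  by_contra h
  apply hj
  unfold qBinI
  rw [if_neg h, mul_zero]

def Fq (Q : ℝ) (P b n s : ℤ) : ℝ :=
  ∑' j : ℤ, Q ^ (j * (P * j + P - s)) * qBinI Q n ((n + s - b) / 2 - P * j)

lemma X_split (hQ : Q ≠ 0) (P b n s : ℤ) (hP : 0 < P) :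
    Xcfg Q 1 P 1 s b n = Fq Q P b n s - Q ^ s * Fq Q P b n (-s) := by
  unfold Xcfg Fq
  rw [← tsum_mul_left, ← Summable.tsum_sub (fin_summ _ _ _ _ hP)
    ((fin_summ _ _ _ _ hP).mul_left _)]
  apply tsum_congr
  intro j
  have e1 : j * (1 * P * j + P * 1 - 1 * s) = j * (P * j + P - s) := by ring
  have e2 : (1 * j + 1) * (P * j + s) = s + j * (P * j + P - -s) := by ring
  have e3 : n + -s - b = n - s - b := by ring
  rw [e1, e2, e3, zpow_add₀ hQ]
  ring

lemma Fq_shift (hQ : Q ≠ 0) (P b n s m : ℤ) :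
    Fq Q P b n s = Q ^ (m * (P * m + P - s)) * Fq Q P b n (s - 2 * P * m) := by
  unfold Fq
  rw [← tsum_mul_left, ← (Equiv.addRight m).tsum_eq]
  apply tsum_congr
  intro j
  simp only [Equiv.coe_addRight]
  have e1 : (n + s - b) / 2 - P * (j + m) = (n + (s - 2 * P * m) - b) / 2 - P * j := by
    have h1 : P * (j + m) = P * j + P * m := by ring
    have h2 : 2 * P * m = 2 * (P * m) := by ring
    rw [h1, h2]; omega
  rw [e1, ← mul_assoc, ← zpow_add₀ hQ]
  congr 2
  ring

lemma X_shift (hQ : Q ≠ 0) (P b n s m : ℤ) (hP : 0 < P) :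
    Xcfg Q 1 P 1 s b n = Q ^ (m * (P * m + P - s)) * Xcfg Q 1 P 1 (s - 2 * P * m) b n := by
  rw [X_split hQ _ _ _ _ hP, X_split hQ _ _ _ _ hP, mul_sub, ← Fq_shift hQ]
  have h := Fq_shift hQ P b n (-(s - 2 * P * m)) m
  have e : -(s - 2 * P * m) - 2 * P * m = -s := by ring
  rw [e] at h
  rw [h, ← mul_assoc, ← mul_assoc, ← zpow_add₀ hQ, ← zpow_add₀ hQ]
  congr 3
  ring

lemma X_neg (hQ : Q ≠ 0) (P b n s : ℤ) (hP : 0 < P) :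
    Xcfg Q 1 P 1 (-s) b n = - (Q ^ (-s) * Xcfg Q 1 P 1 s b n) := by
  rw [X_split hQ _ _ _ _ hP, X_split hQ _ _ _ _ hP, neg_neg, mul_sub, ← mul_assoc, ← zpow_add₀ hQ]
  simp

lemma X_zero (hQ : Q ≠ 0) (P b n : ℤ) (hP : 0 < P) : Xcfg Q 1 P 1 0 b n = 0 := by
  have := X_neg hQ P b n 0 hP
  simp at this
  linarith

lemma X_P (hQ : Q ≠ 0) (P b n : ℤ) (hP : 0 < P) : Xcfg Q 1 P 1 P b n = 0 := by
  have h1 := X_neg hQ P b n P hP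
  have h2 := X_shift hQ P b n P 1 hP
  have e1 : P - 2 * P * 1 = -P := by ring
  have e2 : 1 * (P * 1 + P - P) = P := by ring
  rw [e1, e2, h1, mul_neg, ← mul_assoc, ← zpow_add₀ hQ] at h2
  simp at h2
  linarith

/-- sum over all integers by residue classes mod `2(k+2)` -/
lemma fold_int (k : ℕ) (W : ℤ → ℝ) (hW : Summable W)
    (h0 : ∀ j : ℤ, W (0 - 2 * ((k : ℤ) + 2) * j) = 0)
    (hP : ∀ j : ℤ, W (((k : ℤ) + 2) - 2 * ((k : ℤ) + 2) * j) = 0) :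
    ∑' s, W s = ∑ i ∈ Finset.range (k + 1),
      ((∑' j : ℤ, W (((i : ℤ) + 1) - 2 * ((k : ℤ) + 2) * j)) +
        ∑' j : ℤ, W (-((i : ℤ) + 1) - 2 * ((k : ℤ) + 2) * j)) := by
  set n : ℕ := 1 + (k + 1) + 1 + (k + 1) with hn
  have : NeZero n := ⟨by omega⟩
  have hnc : (n : ℤ) = 2 * ((k : ℤ) + 2) := by rw [hn]; push_cast; ring
  let E : Fin n × ℤ ≃ ℤ := (Equiv.prodComm _ _).trans
    ((Equiv.prodCongr (Equiv.neg ℤ) (Equiv.refl _)).trans (Int.divModEquiv n).symm)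
  have hE : ∀ x : Fin n × ℤ, E x = ((x.1 : ℕ) : ℤ) - 2 * ((k : ℤ) + 2) * x.2 := by
    intro x
    simp [E, Int.divModEquiv_symm_apply, hnc]
    ring
  have hWE : Summable (fun x => W (E x)) := (Equiv.summable_iff E).mpr hW
  rw [← E.tsum_eq, hWE.tsum_prod, tsum_fintype]
  simp only [hE]
  set G : ℤ → ℝ := fun ρ => ∑' j : ℤ, W (ρ - 2 * ((k : ℤ) + 2) * j) with hG
  have hg : ∑ b : Fin n, ∑' c : ℤ, W (((b : ℕ) : ℤ) - 2 * ((k : ℤ) + 2) * c) = ∑ ρ ∈ Finset.range n, G (ρ : ℤ) :=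
    Fin.sum_univ_eq_sum_range (fun ρ => G (ρ : ℤ)) n
  rw [hg, hn, Finset.sum_range_add, Finset.sum_range_add, Finset.sum_range_add]
  have z0 : G 0 = 0 := by
    simp only [hG, h0, tsum_zero]
  have zP : G ((k : ℤ) + 2) = 0 := by
    simp only [hG, hP, tsum_zero]
  simp only [Finset.sum_range_one]
  rw [← Finset.sum_range_reflect (fun x => G ((1 + (k + 1) + 1 + x : ℕ) : ℤ))]
  have e1 : G ((0 : ℕ) : ℤ) = 0 := by simpa using z0
  have e2 : G ((1 + (k + 1) + 0 : ℕ) : ℤ) = 0 := by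
    rw [← zP]; congr 1; push_cast; ring
  rw [e1, e2, Finset.sum_add_distrib, zero_add, add_zero]
  congr 1
  · apply Finset.sum_congr rfl
    intro i _
    show G _ = G _
    congr 1; push_cast; ring
  · apply Finset.sum_congr rfl
    intro i hi
    have hi' : i < k + 1 := Finset.mem_range.mp hi
    simp only [hG]
    rw [← (Equiv.addRight (1 : ℤ)).tsum_eq]
    apply tsum_congr
    intro j
    congr 1
    simp only [Equiv.coe_addRight]
    have : ((1 + (k + 1) + 1 + (k + 1 - 1 - i) : ℕ) : ℤ) = 2 * ((k : ℤ) + 2) - (i + 1) := by omega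
    rw [this]
    ring

end XX

section inner
variable {q : ℝ}

lemma fin_summ' (c : ℤ → ℝ) (n : ℤ) (g : ℤ → ℤ) (hinj : Function.Injective g) :
    Summable (fun j : ℤ => c j * qBinI q n (g j)) := by
  apply summable_of_hasFiniteSupport
  refine ((Set.finite_Icc (0 : ℤ) n).preimage hinj.injOn).subset ?_
  intro j hj
  simp only [Function.mem_support] at hj
  simp only [Set.mem_preimage, Set.mem_Icc]
  by_contra h
  apply hj
  unfold qBinI
  rw [if_neg h, mul_zero]

lemma inner1 (hq0 : 0 < q) (k : ℕ) (b n r L : ℤ) :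
    (∑ i ∈ Finset.range (k + 1), (if (2 : ℤ) ∣ ((i : ℤ) - r) then
        Xcfg q⁻¹ 1 ((k : ℤ) + 2) 1 ((i : ℤ) + 1) b n *
          Xcfg q 1 ((k : ℤ) + 2) 1 ((i : ℤ) + 1) 1 (2 * L + r) else 0))
    = ∑' a : ℤ, Xcfg q⁻¹ 1 ((k : ℤ) + 2) 1 (2 * a + 1 - r) b n * qBinI q (2 * L + r) (L + a) := by
  set P : ℤ := (k : ℤ) + 2 with hPdef
  have hP : 0 < P := by omega
  have hQ : q⁻¹ ≠ 0 := inv_ne_zero hq0.ne'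
  set X : ℤ → ℝ := fun s => Xcfg q⁻¹ 1 P 1 s b n with hX
  set T : ℤ → ℝ := fun s => qBinI q (2 * L + r) ((2 * L + r + s - 1) / 2) with hT
  set W : ℤ → ℝ := fun s => if (2 : ℤ) ∣ s - (r + 1) then X s * T s else 0 with hW
  have hinj : Function.Injective (fun a : ℤ => 2 * a + 1 - r) := by
    intro x y h; simp only at h; omega
  have hWa : ∀ a : ℤ, W (2 * a + 1 - r) = X (2 * a + 1 - r) * qBinI q (2 * L + r) (L + a) := by
    intro a
    simp only [hW, hT]
    rw [if_pos (by omega)]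
    congr 2
    omega
  have hWout : ∀ s, s ∉ Set.range (fun a : ℤ => 2 * a + 1 - r) → W s = 0 := by
    intro s hs
    simp only [hW]
    rw [if_neg]
    rintro ⟨c, hc⟩
    exact hs ⟨c + r, by simp only; omega⟩
  have hWs : Summable W := by
    rw [← hinj.summable_iff hWout]
    refine (fin_summ' (q := q) (fun a => X (2 * a + 1 - r)) (2 * L + r) (fun a => L + a) (fun x y h => by simpa using h)).congr ?_
    intro a
    exact (hWa a).symm
  have hA : ∑' a : ℤ, X (2 * a + 1 - r) * qBinI q (2 * L + r) (L + a) = ∑' s, W s := by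
    rw [← hinj.tsum_eq (f := W)]
    · exact tsum_congr (fun a => (hWa a).symm)
    · intro s hs
      by_contra h
      exact hs (hWout s h)
  have hXs : ∀ s m : ℤ, q ^ (m * (P * m + P - s)) * X s = X (s - 2 * P * m) := by
    intro s m
    have h := X_shift hQ P b n s m hP
    simp only [hX]
    rw [h, ← mul_assoc, inv_zpow, mul_inv_cancel₀ (zpow_ne_zero _ hq0.ne'), one_mul]
  have hXn : ∀ s : ℤ, X (-s) = -(q ^ s * X s) := by
    intro s
    have h := X_neg hQ P b n s hP
    simp only [hX]
    rw [h, inv_zpow', neg_neg]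
  have hX0 : X 0 = 0 := X_zero hQ P b n hP
  have hXP : X P = 0 := X_P hQ P b n hP
  show _ = ∑' a : ℤ, X (2 * a + 1 - r) * qBinI q (2 * L + r) (L + a)
  rw [hA, fold_int k W hWs]
  · apply Finset.sum_congr rfl
    intro i _
    rw [← hPdef]
    have par1 : ∀ j : ℤ, ((2 : ℤ) ∣ ((i : ℤ) + 1 - 2 * P * j) - (r + 1)) ↔ (2 : ℤ) ∣ (i : ℤ) - r := by
      intro j
      have : 2 * P * j = 2 * (P * j) := by ring
      rw [this]; omega
    have par2 : ∀ j : ℤ, ((2 : ℤ) ∣ (-((i : ℤ) + 1) - 2 * P * j) - (r + 1)) ↔ (2 : ℤ) ∣ (i : ℤ) - r := by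
      intro j
      have : 2 * P * j = 2 * (P * j) := by ring
      rw [this]; omega
    by_cases hpar : (2 : ℤ) ∣ (i : ℤ) - r
    · rw [if_pos hpar]
      have inj1 : ∀ c : ℤ, Function.Injective (fun j : ℤ => c - 2 * P * j) := by
        intro c x y h
        simp only [sub_right_inj] at h
        exact mul_left_cancel₀ (by omega) h
      have c1 : Summable (fun j : ℤ => W ((i : ℤ) + 1 - 2 * P * j)) := hWs.comp_injective (inj1 _)
      have c2 : Summable (fun j : ℤ => W (-((i : ℤ) + 1) - 2 * P * j)) := hWs.comp_injective (inj1 _)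
      rw [← c1.tsum_add c2]
      show X ((i : ℤ) + 1) * _ = _
      unfold Xcfg
      rw [← tsum_mul_left]
      apply tsum_congr
      intro j
      simp only [hW, par1, par2, if_pos hpar]
      set s : ℤ := (i : ℤ) + 1 with hs
      rw [← hXs s j, ← hXs (-s) j, hXn]
      have e1 : (2 * L + r + s - 1) / 2 - P * j = (2 * L + r + (s - 2 * P * j) - 1) / 2 := by
        have : 2 * P * j = 2 * (P * j) := by ring
        rw [this]; omega
      have e2 : (2 * L + r - s - 1) / 2 - P * j = (2 * L + r + (-s - 2 * P * j) - 1) / 2 := by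
        have : 2 * P * j = 2 * (P * j) := by ring
        rw [this]; omega
      have e3 : j * (1 * P * j + P * 1 - 1 * s) = j * (P * j + P - s) := by ring
      have e4 : (1 * j + 1) * (P * j + s) = j * (P * j + P - -s) + s := by ring
      rw [e1, e2, e3, e4, zpow_add₀ hq0.ne']
      simp only [hT]
      ring
    · rw [if_neg hpar]
      simp only [hW, par1, par2, if_neg hpar, tsum_zero, add_zero]
  · intro j
    rw [← hPdef]
    simp only [hW]
    rw [← hXs, hX0]; simp
  · intro j
    rw [← hPdef]
    simp only [hW]
    rw [← hXs, hXP]; simp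

lemma inner2 (hq0 : 0 < q) (k : ℕ) (b n r L : ℤ) :
    (∑ i ∈ Finset.range (k + 1), (if (2 : ℤ) ∣ ((i : ℤ) - r) then
        Xcfg q⁻¹ 1 ((k : ℤ) + 2) 1 ((i : ℤ) + 1) b n *
          Xcfg q 1 ((k : ℤ) + 2) 1 ((i : ℤ) + 1) 1 (2 * L + r) else 0))
    = ∑' a : ℤ, Fq q⁻¹ ((k : ℤ) + 2) b n (2 * a + 1 - r) *
        (qBinI q (2 * L + r) (L + a) - q ^ (2 * a + 1 - r) * qBinI q (2 * L + r) (L + (r - 1 - a))) := by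
  rw [inner1 hq0]
  have hP : (0 : ℤ) < (k : ℤ) + 2 := by omega
  have hQ : q⁻¹ ≠ 0 := inv_ne_zero hq0.ne'
  set F : ℤ → ℝ := Fq q⁻¹ ((k : ℤ) + 2) b n with hF
  have i1 : Function.Injective (fun a : ℤ => L + a) := fun x y h => by simpa using h
  have i2 : Function.Injective (fun a : ℤ => L + (r - 1 - a)) := fun x y h => by simpa using h
  have s1 := fin_summ' (q := q) (fun a => F (2 * a + 1 - r)) (2 * L + r) _ i1
  have s2 := fin_summ' (q := q) (fun a => q⁻¹ ^ (2 * a + 1 - r) * F (-(2 * a + 1 - r))) (2 * L + r) _ i1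
  have s3 := fin_summ' (q := q) (fun a => q ^ (2 * a + 1 - r) * F (2 * a + 1 - r)) (2 * L + r) _ i2
  have e1 : ∑' a : ℤ, Xcfg q⁻¹ 1 ((k : ℤ) + 2) 1 (2 * a + 1 - r) b n * qBinI q (2 * L + r) (L + a)
      = ∑' a : ℤ, (F (2 * a + 1 - r) * qBinI q (2 * L + r) (L + a) -
        q⁻¹ ^ (2 * a + 1 - r) * F (-(2 * a + 1 - r)) * qBinI q (2 * L + r) (L + a)) := by
    apply tsum_congr
    intro a
    rw [X_split hQ _ _ _ _ hP, sub_mul]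
  have e2 : ∑' a : ℤ, F (2 * a + 1 - r) *
        (qBinI q (2 * L + r) (L + a) - q ^ (2 * a + 1 - r) * qBinI q (2 * L + r) (L + (r - 1 - a)))
      = ∑' a : ℤ, (F (2 * a + 1 - r) * qBinI q (2 * L + r) (L + a) -
        q ^ (2 * a + 1 - r) * F (2 * a + 1 - r) * qBinI q (2 * L + r) (L + (r - 1 - a))) := by
    apply tsum_congr
    intro a
    ring
  rw [e1, e2, s1.tsum_sub s2, s1.tsum_sub s3]
  congr 1
  rw [← (Equiv.subLeft (r - 1)).tsum_eq]
  apply tsum_congr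
  intro a
  simp only [Equiv.subLeft_apply]
  have e3 : 2 * (r - 1 - a) + 1 - r = -(2 * a + 1 - r) := by ring
  rw [e3, inv_zpow', neg_neg]

end inner

section main
variable {q : ℝ}

lemma ch2_cast (n : ℤ) : ((ch2 n : ℤ) : ℝ) = (n : ℝ) * (n - 1) / 2 := by
  unfold ch2
  have h : (2 : ℤ) ∣ n * (n - 1) := (Int.even_mul_pred_self n).two_dvd
  rw [Int.cast_div h (by norm_num)]
  push_cast; ring

lemma V_hasSum (hq0 : 0 < q) (hq1 : q < 1) (t : ℤ) :
    HasSum (fun e : ℤ => q ^ ((2 * (e : ℝ) - t) * (2 * (e : ℝ) - t - 1) / 2 + e) * Bf q e)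
      (qPInf q q * V q t) := by
  set g : ℤ → ℝ := fun e => q ^ ((2 * (e : ℝ) - t) * (2 * (e : ℝ) - t - 1) / 2 + e) with hg
  have hgs : Summable g := by
    refine (summ_gauss hq0 hq1 2 (-2 * t) ((t : ℝ) * (t + 1) / 2) (by norm_num)).congr (fun e => ?_)
    simp only [hg]; congr 1; ring
  have hg0 : ∀ e, 0 ≤ g e := fun e => (Real.rpow_pos_of_pos hq0 _).le
  set f : ℤ × ℤ → ℝ := fun x => g x.1 * Bt q x.1 x.2 with hf
  have hfs : Summable f := by
    refine (hgs.mul_of_nonneg ((summ_abs hq0 hq1).mul_right (cbd q)) hg0 (fun i => ?_)).of_nonneg_of_le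
      (fun x => mul_nonneg (hg0 _) (Bt_nonneg hq0 hq1 _ _))
      (fun x => mul_le_mul_of_nonneg_left (Bt_le hq0 hq1 _ _) (hg0 _))
    have := cbd_pos hq0 hq1
    simp only [Pi.zero_apply]
    positivity
  have h1 : HasSum (fun e => g e * Bf q e) (∑' x, f x) :=
    hfs.hasSum.prod_fiberwise (fun e => (Bt_summable hq0 hq1 e).hasSum.mul_left (g e))
  refine hasSum_eqv h1 (fun _ => rfl) ?_
  unfold V
  rw [← mul_assoc, mul_inv_cancel₀ (qPInf_ne hq0 hq1), one_mul]
  have hinj : Function.Injective (fun ij : ℕ × ℕ => (((ij.2 : ℤ) - ij.1, (ij.1 : ℤ)) : ℤ × ℤ)) := by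
    rintro ⟨x1, x2⟩ ⟨y1, y2⟩ h
    simp only [Prod.mk.injEq] at h
    ext <;> simp only <;> omega
  rw [← hinj.tsum_eq (f := f)]
  · apply tsum_congr
    rintro ⟨i, j⟩
    simp only [hf, hg, Bt]
    have e1 : (i : ℤ) + ((j : ℤ) - i) = j := by ring
    have e2 : q ^ (((ch2 (2 * (j : ℤ) - 2 * (i : ℤ) - t) + (j : ℤ) : ℤ)) : ℝ) =
        q ^ ((2 * (((j : ℤ) - (i : ℤ) : ℤ) : ℝ) - t) * (2 * (((j : ℤ) - (i : ℤ) : ℤ) : ℝ) - t - 1) / 2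
          + (((j : ℤ) - (i : ℤ) : ℤ) : ℝ)) * q ^ (((i : ℤ)) : ℝ) := by
      rw [← Real.rpow_add hq0]
      congr 1
      push_cast
      rw [ch2_cast]
      push_cast
      ring
    rw [e1, invQ_nat, invQ_nat, e2]
    ring
  · rintro ⟨e, i⟩ hx
    simp only [hf, Bt, Function.mem_support] at hx
    by_cases hi : i < 0
    · exact absurd (by rw [invQ_neg hi]; ring) hx
    by_cases hj : i + e < 0
    · exact absurd (by rw [invQ_neg hj]; ring) hx
    refine ⟨(i.toNat, (i + e).toNat), ?_⟩
    ext <;> simp only <;> omega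

lemma gauss2 (hq0 : 0 < q) (hq1 : q < 1) (P b r : ℤ) (hP : 0 < P) (ε : ℝ) :
    Summable (fun x : ℤ × ℤ => q ^ (-((x.2 : ℝ) * (P * x.2 + P - (2 * x.1 + 1 - r))) +
      ((2 * (x.1 : ℝ) + 1 - r) - b - 2 * P * x.2) ^ 2 / 2 + ε * (2 * (x.1 : ℝ) + 1 - r))) := by
  have hP' : (1 : ℝ) ≤ P := by exact_mod_cast hP
  have h1 := summ_gauss hq0 hq1 (1 / 2) ε 0 (by norm_num)
  have h2 := summ_gauss hq0 hq1 ((2 * P - 1) / 2) (b - P + ε * (2 * P - 1)) (ε * b) (by linarith)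
  have h3 := h1.mul_of_nonneg h2 (fun _ => (Real.rpow_pos_of_pos hq0 _).le) (fun _ => (Real.rpow_pos_of_pos hq0 _).le)
  have hinj : Function.Injective (fun x : ℤ × ℤ => ((2 * x.1 + 1 - r - b - (2 * P - 1) * x.2, x.2) : ℤ × ℤ)) := by
    rintro ⟨x1, x2⟩ ⟨y1, y2⟩ h
    simp only [Prod.mk.injEq] at h
    obtain ⟨h1, rfl⟩ := h
    have : x1 = y1 := by linarith
    rw [this]
  refine (h3.comp_injective hinj).congr (fun x => ?_)
  simp only [Function.comp]
  rw [← Real.rpow_add hq0]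
  congr 1
  push_cast
  ring

lemma Dt_nonneg (hq0 : 0 < q) (hq1 : q < 1) (r a L : ℤ) : 0 ≤ Dt q r a L := by
  unfold Dt
  have h1 := II_nonneg hq0 hq1 L (L + r)
  have h2 := II_nonneg hq0 hq1 (L + a) (L + r - a)
  have h3 := (qP_pos hq0 hq1 (2 * L + r).toNat).le
  positivity

lemma Dt_le (hq0 : 0 < q) (hq1 : q < 1) (r a L : ℤ) : Dt q r a L ≤ q ^ (L : ℝ) * (cbd q * cbd q) := by
  unfold Dt
  have hc := (cbd_pos hq0 hq1).le
  have h1 := II_nonneg hq0 hq1 L (L + r)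
  have h1' : _ ≤ cbd q := II_le hq0 hq1 L (L + r)
  have h2 := II_nonneg hq0 hq1 (L + a) (L + r - a)
  have h2' : _ ≤ cbd q := II_le hq0 hq1 (L + a) (L + r - a)
  have h3 := (qP_pos hq0 hq1 (2 * L + r).toNat).le
  have h3' := qP_le_one hq0 hq1 (2 * L + r).toNat
  refine mul_le_mul_of_nonneg_left ?_ (Real.rpow_pos_of_pos hq0 _).le
  refine mul_le_mul h1' ?_ (mul_nonneg h3 h2) hc
  calc _ ≤ 1 * cbd q := mul_le_mul h3' h2' h2 zero_le_one
    _ = _ := one_mul _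

/-- exponent -/
def yy (q : ℝ) (P b r : ℤ) (a j : ℤ) : ℝ :=
  q ^ (-((j : ℝ) * (P * j + P - (2 * a + 1 - r))) + ((2 * (a : ℝ) + 1 - r) - b - 2 * P * j) ^ 2 / 2)

def tt (q : ℝ) (P b r : ℤ) (a j n : ℤ) : ℝ :=
  q ^ (-((j : ℝ) * (P * j + P - (2 * a + 1 - r)))) * At q ((2 * a + 1 - r) - b - 2 * P * j) n

lemma tt_hasSum (hq0 : 0 < q) (hq1 : q < 1) (P b r a j : ℤ) :
    HasSum (fun n : ℕ => tt q P b r a j n) (yy q P b r a j * (qPInf q q)⁻¹) := by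
  refine hasSum_eqv ((At_hasSum hq0 hq1 ((2 * a + 1 - r) - b - 2 * P * j)).mul_left
    (q ^ (-((j : ℝ) * (P * j + P - (2 * a + 1 - r)))))) (fun n => rfl) ?_
  rw [← mul_assoc, ← Real.rpow_add hq0]
  unfold yy
  push_cast
  rfl

lemma tt_nonneg (hq0 : 0 < q) (hq1 : q < 1) (P b r a j n : ℤ) : 0 ≤ tt q P b r a j n :=
  mul_nonneg (Real.rpow_pos_of_pos hq0 _).le (At_nonneg hq0 hq1 _ _)

def hh (q : ℝ) (r ℓ a L : ℤ) : ℝ :=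
  q ^ (((r : ℝ) - ℓ) / 2) * (Dt q r a L - q ^ ((2 * a + 1 - r : ℝ)) * Dt q r (a + 1) L)

lemma hh_hasSum (hq0 : 0 < q) (hq1 : q < 1) (r ℓ a : ℤ) :
    HasSum (fun L : ℕ => hh q r ℓ a L)
      (q ^ (((r : ℝ) - ℓ) / 2) * ((Bf q (r - a) - q ^ ((2 * a + 1 - r : ℝ)) * Bf q (a + 1)) * (qPInf q q)⁻¹)) := by
  have hz : ∀ n : ℤ, n ∉ Set.range (fun n : ℕ => (n : ℤ)) → hh q r ℓ a n = 0 := by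
    intro n hn
    have hneg : n < 0 := by
      by_contra h
      exact hn ⟨n.toNat, Int.toNat_of_nonneg (not_lt.mp h)⟩
    unfold hh Dt
    rw [invQ_neg hneg]; ring
  have hinj : Function.Injective (fun n : ℕ => (n : ℤ)) := fun x y h => Int.ofNat_inj.mp h
  have key := (Function.Injective.hasSum_iff (f := hh q r ℓ a) hinj hz).mpr
    ((key_hasSum hq0 hq1 r a).mul_left (q ^ (((r : ℝ) - ℓ) / 2)))
  exact key

lemma hh_abs (hq0 : 0 < q) (hq1 : q < 1) (r ℓ a : ℤ) (L : ℕ) :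
    |hh q r ℓ a L| ≤ (1 + q ^ ((2 * a + 1 - r : ℝ))) * (q ^ (((r : ℝ) - ℓ) / 2) * (cbd q * cbd q) * q ^ L) := by
  unfold hh
  have h1 := Dt_nonneg hq0 hq1 r a L
  have h2 := Dt_nonneg hq0 hq1 r (a + 1) L
  have h3 := Dt_le hq0 hq1 r a L
  have h4 := Dt_le hq0 hq1 r (a + 1) L
  have e : q ^ (((L : ℤ) : ℝ)) = q ^ L := by simp
  rw [e] at h3 h4
  have h5 : 0 < q ^ ((2 * a + 1 - r : ℝ)) := Real.rpow_pos_of_pos hq0 _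
  have h6 : 0 < q ^ (((r : ℝ) - ℓ) / 2) := Real.rpow_pos_of_pos hq0 _
  rw [abs_mul, abs_of_pos h6]
  have h7 : |Dt q r a L - q ^ ((2 * a + 1 - r : ℝ)) * Dt q r (a + 1) L| ≤
      (1 + q ^ ((2 * a + 1 - r : ℝ))) * (q ^ L * (cbd q * cbd q)) := by
    have h8 : q ^ ((2 * a + 1 - r : ℝ)) * Dt q r (a + 1) L ≤ q ^ ((2 * a + 1 - r : ℝ)) * (q ^ L * (cbd q * cbd q)) :=
      mul_le_mul_of_nonneg_left h4 h5.le
    have h9 : 0 ≤ q ^ ((2 * a + 1 - r : ℝ)) * Dt q r (a + 1) L := by positivity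
    rw [abs_le]
    constructor <;> linarith
  calc _ ≤ q ^ (((r : ℝ) - ℓ) / 2) * ((1 + q ^ ((2 * a + 1 - r : ℝ))) * (q ^ L * (cbd q * cbd q))) :=
        mul_le_mul_of_nonneg_left h7 h6.le
    _ = _ := by ring

def Phi (q : ℝ) (P b r ℓ : ℤ) (x : ((ℤ × ℤ) × ℕ) × ℕ) : ℝ :=
  tt q P b r x.1.1.1 x.1.1.2 x.1.2 * hh q r ℓ x.1.1.1 x.2

lemma Phi_summable (hq0 : 0 < q) (hq1 : q < 1) (P b r ℓ : ℤ) (hP : 0 < P) :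
    Summable (Phi q P b r ℓ) := by
  set A : (ℤ × ℤ) × ℕ → ℝ := fun x => tt q P b r x.1.1 x.1.2 x.2 * (1 + q ^ ((2 * x.1.1 + 1 - r : ℝ))) with hA
  have hA0 : 0 ≤ A := fun x => mul_nonneg (tt_nonneg hq0 hq1 _ _ _ _ _ _)
    (by have := Real.rpow_pos_of_pos hq0 (2 * x.1.1 + 1 - r : ℝ); linarith)
  have hAs : Summable A := by
    rw [summable_prod_of_nonneg hA0]
    have hS : ∀ x : ℤ × ℤ, HasSum (fun n => A (x, n)) (yy q P b r x.1 x.2 * (qPInf q q)⁻¹ * (1 + q ^ ((2 * x.1 + 1 - r : ℝ)))) :=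
      fun x => (tt_hasSum hq0 hq1 P b r x.1 x.2).mul_right _
    refine ⟨fun x => (hS x).summable, ?_⟩
    have g0 := gauss2 hq0 hq1 P b r hP 0
    have g1 := gauss2 hq0 hq1 P b r hP 1
    refine ((g0.add g1).mul_right (qPInf q q)⁻¹).congr (fun x => ?_)
    rw [(hS x).tsum_eq]
    unfold yy
    simp only [zero_mul, add_zero, one_mul]
    rw [Real.rpow_add hq0 _ (2 * (x.1 : ℝ) + 1 - r)]
    ring
  have hL : Summable (fun L : ℕ => q ^ (((r : ℝ) - ℓ) / 2) * (cbd q * cbd q) * q ^ L) :=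
    (summable_geometric_of_lt_one hq0.le hq1).mul_left _
  have hL0 : 0 ≤ (fun L : ℕ => q ^ (((r : ℝ) - ℓ) / 2) * (cbd q * cbd q) * q ^ L) := by
    intro L
    have := cbd_pos hq0 hq1
    simp only [Pi.zero_apply]; positivity
  refine (hAs.mul_of_nonneg hL hA0 hL0).of_norm_bounded (fun x => ?_)
  unfold Phi
  rw [norm_mul, Real.norm_of_nonneg (tt_nonneg hq0 hq1 _ _ _ _ _ _), Real.norm_eq_abs]
  simp only [hA]
  rw [mul_assoc]
  exact mul_le_mul_of_nonneg_left (hh_abs hq0 hq1 _ _ _ _) (tt_nonneg hq0 hq1 _ _ _ _ _ _)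

end main

section final
variable {q : ℝ}

lemma tt_eq (hq0 : 0 < q) (P r ℓ a j : ℤ) (n : ℕ) (h : (2 : ℤ) ∣ (n : ℤ) - (r + ℓ)) :
    tt q P (ℓ + 1) r a j n = q ^ ((n : ℝ) ^ 2 / 2) * (qP q q n)⁻¹ *
      (q⁻¹ ^ (j * (P * j + P - (2 * a + 1 - r))) *
        qBinI q⁻¹ n (((n : ℤ) + (2 * a + 1 - r) - (ℓ + 1)) / 2 - P * j)) := by
  unfold tt At
  have hp : 2 * P * j = 2 * (P * j) := by ring
  rw [hp]
  have h1 : (2 : ℤ) ∣ (n : ℤ) - ((2 * a + 1 - r) - (ℓ + 1) - 2 * (P * j)) := by omega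
  have h2 : ((n : ℤ) + ((2 * a + 1 - r) - (ℓ + 1) - 2 * (P * j))) / 2 =
      ((n : ℤ) + (2 * a + 1 - r) - (ℓ + 1)) / 2 - P * j := by omega
  rw [if_pos h1, h2, invQ_nat]
  have h3 : q ^ (-((j : ℝ) * (P * j + P - (2 * a + 1 - r)))) =
      q⁻¹ ^ (j * (P * j + P - (2 * a + 1 - r))) := by
    rw [inv_zpow, ← Real.rpow_intCast, Real.rpow_neg hq0.le]
    push_cast
    rfl
  rw [h3]
  push_cast
  ring

lemma tt_zero (P r ℓ a j : ℤ) (n : ℕ) (h : ¬ (2 : ℤ) ∣ (n : ℤ) - (r + ℓ)) :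
    tt q P (ℓ + 1) r a j n = 0 := by
  unfold tt At
  have hp : 2 * P * j = 2 * (P * j) := by ring
  rw [hp, if_neg (by omega), mul_zero]

lemma hh_eq (hq0 : 0 < q) (r ℓ a : ℤ) (L : ℕ) :
    hh q r ℓ a L = q ^ ((2 * (L : ℝ) + (r : ℝ) - (ℓ : ℝ)) / 2) *
      ((qP q q L)⁻¹ * invQ q ((L : ℤ) + r)) *
      (qBinI q (2 * (L : ℤ) + r) ((L : ℤ) + a) -
        q ^ (2 * a + 1 - r) * qBinI q (2 * (L : ℤ) + r) ((L : ℤ) + (r - 1 - a))) := by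
  unfold hh Dt
  rw [qBinI_eq, qBinI_eq, invQ_nat]
  have e1 : 2 * (L : ℤ) + r - ((L : ℤ) + a) = L + r - a := by ring
  have e2 : 2 * (L : ℤ) + r - ((L : ℤ) + (r - 1 - a)) = L + (a + 1) := by ring
  have e3 : (L : ℤ) + (r - 1 - a) = L + r - (a + 1) := by ring
  have e4 : q ^ ((2 * (L : ℝ) + (r : ℝ) - (ℓ : ℝ)) / 2) =
      q ^ (((r : ℝ) - ℓ) / 2) * q ^ (((L : ℤ)) : ℝ) := by
    rw [← Real.rpow_add hq0]; congr 1; push_cast; ring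
  have e5 : q ^ (2 * (a : ℝ) + 1 - r) = q ^ (2 * a + 1 - r) := by
    rw [← Real.rpow_intCast]; push_cast; rfl
  rw [e1, e2, e3, e4, e5]
  ring

lemma rhs_term (hq0 : 0 < q) (k : ℕ) (r ℓ : ℤ) (n : ℕ) :
    (if (2 : ℤ) ∣ ((n : ℤ) - (r + ℓ)) then
          q ^ (((n : ℝ) ^ 2) / 2) * (qP q q n)⁻¹ *
            ∑' L : ℕ,
              q ^ ((2 * (L : ℝ) + (r : ℝ) - (ℓ : ℝ)) / 2) *
                ((qP q q L)⁻¹ * invQ q ((L : ℤ) + r)) *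
                ∑ i ∈ Finset.range (k + 1),
                  (if (2 : ℤ) ∣ ((i : ℤ) - r) then
                    Xcfg q⁻¹ 1 ((k : ℤ) + 2) 1 ((i : ℤ) + 1) (ℓ + 1) (n : ℤ) *
                      Xcfg q 1 ((k : ℤ) + 2) 1 ((i : ℤ) + 1) 1 (2 * (L : ℤ) + r)
                  else 0)
        else 0) = ∑' L : ℕ, ∑' a : ℤ, ∑' j : ℤ, Phi q ((k : ℤ) + 2) (ℓ + 1) r ℓ (((a, j), n), L) := by
  unfold Phi
  split_ifs with h
  · rw [← tsum_mul_left]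
    refine tsum_congr (fun L => ?_)
    rw [inner2 hq0, ← tsum_mul_left, ← tsum_mul_left]
    refine tsum_congr (fun a => ?_)
    simp only
    rw [tsum_mul_right, hh_eq hq0]
    simp_rw [tt_eq hq0 _ _ _ _ _ _ h]
    rw [tsum_mul_left]
    unfold Fq
    ring
  · simp_rw [tt_zero _ _ _ _ _ _ h]
    simp

/-- reordering -/
def eqvR : ℕ × (ℕ × (ℤ × ℤ)) ≃ ((ℤ × ℤ) × ℕ) × ℕ where
  toFun x := ((x.2.2, x.1), x.2.1)
  invFun y := (y.1.2, (y.2, y.1.1))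
  left_inv _ := rfl
  right_inv _ := rfl

lemma tsum_reorder (F : ((ℤ × ℤ) × ℕ) × ℕ → ℝ) (hF : Summable F) :
    ∑' n : ℕ, ∑' L : ℕ, ∑' a : ℤ, ∑' j : ℤ, F (((a, j), n), L) = ∑' x, F x := by
  have h1 : Summable (fun x => F (eqvR x)) := eqvR.summable_iff.mpr hF
  rw [← eqvR.tsum_eq, h1.tsum_prod]
  refine tsum_congr (fun n => ?_)
  have h2 := h1.prod_factor n
  rw [h2.tsum_prod]
  refine tsum_congr (fun L => ?_)
  have h3 := h2.prod_factor L
  rw [h3.tsum_prod]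
  rfl

/-- the summand over `(a,j)` -/
def GG (q : ℝ) (P b r ℓ : ℤ) (x : ℤ × ℤ) : ℝ :=
  yy q P b r x.1 x.2 * (qPInf q q)⁻¹ * (q ^ (((r : ℝ) - ℓ) / 2) *
    ((Bf q (r - x.1) - q ^ ((2 * x.1 + 1 - r : ℝ)) * Bf q (x.1 + 1)) * (qPInf q q)⁻¹))

lemma GG_hasSum (hq0 : 0 < q) (hq1 : q < 1) (P b r ℓ : ℤ) (hP : 0 < P) :
    HasSum (GG q P b r ℓ) (∑' x, Phi q P b r ℓ x) := by
  have h := (Phi_summable hq0 hq1 P b r ℓ hP).hasSum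
  have h1 := h.prod_fiberwise (fun y : (ℤ × ℤ) × ℕ =>
    (hh_hasSum hq0 hq1 r ℓ y.1.1).mul_left (tt q P b r y.1.1 y.1.2 y.2))
  exact h1.prod_fiberwise (fun x : ℤ × ℤ => (tt_hasSum hq0 hq1 P b r x.1 x.2).mul_right _)

lemma lhs_term (hq0 : 0 < q) (hq1 : q < 1) (k : ℕ) (r ℓ j : ℤ) :
    q ^ (((j * ((2 * (k : ℤ) + 3) * j + 2 * ℓ + 1) : ℤ) : ℝ) / 2) *
        (V q (r - ℓ - (2 * (k : ℤ) + 3) * j) - V q (r + ℓ + 1 + (2 * (k : ℤ) + 3) * j))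
     = qPInf q q * ∑' a : ℤ, GG q ((k : ℤ) + 2) (ℓ + 1) r ℓ (a, j) := by
  have hne := qPInf_ne hq0 hq1
  have h1 := (Equiv.subLeft r).hasSum_iff.mpr (V_hasSum hq0 hq1 (r - ℓ - (2 * (k : ℤ) + 3) * j))
  have h2 := (Equiv.addRight (1 : ℤ)).hasSum_iff.mpr
    (V_hasSum hq0 hq1 (r + ℓ + 1 + (2 * (k : ℤ) + 3) * j))
  have h3 := ((h1.sub h2).mul_left
    (q ^ (((j * ((2 * (k : ℤ) + 3) * j + 2 * ℓ + 1) : ℤ) : ℝ) / 2))).mul_right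
      ((qPInf q q)⁻¹ * (qPInf q q)⁻¹)
  have h4 : ∑' a : ℤ, GG q ((k : ℤ) + 2) (ℓ + 1) r ℓ (a, j) = _ := (hasSum_eqv h3 (fun a => ?_) rfl).tsum_eq
  · rw [h4]
    field_simp
  · simp only [Function.comp, Equiv.subLeft_apply, Equiv.coe_addRight]
    unfold GG yy
    simp only
    set A := q ^ (((j * ((2 * (k : ℤ) + 3) * j + 2 * ℓ + 1) : ℤ) : ℝ) / 2) with hA
    set Y := q ^ (-((j : ℝ) * (((k : ℤ) + 2 : ℤ) * j + ((k : ℤ) + 2 : ℤ) - (2 * a + 1 - r))) +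
      ((2 * (a : ℝ) + 1 - r) - (ℓ + 1 : ℤ) - 2 * ((k : ℤ) + 2 : ℤ) * j) ^ 2 / 2) with hY
    set W1 := q ^ ((2 * ((r - a : ℤ) : ℝ) - (r - ℓ - (2 * (k : ℤ) + 3) * j : ℤ)) *
      (2 * ((r - a : ℤ) : ℝ) - (r - ℓ - (2 * (k : ℤ) + 3) * j : ℤ) - 1) / 2 + (r - a : ℤ)) with hW1
    set W2 := q ^ ((2 * ((a + 1 : ℤ) : ℝ) - (r + ℓ + 1 + (2 * (k : ℤ) + 3) * j : ℤ)) *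
      (2 * ((a + 1 : ℤ) : ℝ) - (r + ℓ + 1 + (2 * (k : ℤ) + 3) * j : ℤ) - 1) / 2 + (a + 1 : ℤ)) with hW2
    have e1 : A * W1 = Y * q ^ (((r : ℝ) - ℓ) / 2) := by
      rw [hA, hW1, hY, ← Real.rpow_add hq0, ← Real.rpow_add hq0]
      congr 1
      push_cast
      ring
    have e2 : A * W2 = Y * q ^ (((r : ℝ) - ℓ) / 2) * q ^ ((2 * a + 1 - r : ℝ)) := by
      rw [hA, hW2, hY, ← Real.rpow_add hq0, ← Real.rpow_add hq0, ← Real.rpow_add hq0]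
      congr 1
      push_cast
      ring
    linear_combination (-(Bf q (r - a)) * (qPInf q q)⁻¹ * (qPInf q q)⁻¹) * e1 +
      (Bf q (a + 1) * (qPInf q q)⁻¹ * (qPInf q q)⁻¹) * e2

end final


/-- Proposition 2.1: the bosonic graded parafermion character in terms of
ABF one-dimensional configuration sums. -/
theorem graded_parafermion_bosonic_via_ABF
    (k : ℕ) (hk : 1 ≤ k) (ℓ : ℤ) (hℓ0 : 0 ≤ ℓ) (hℓk : ℓ ≤ (k : ℤ)) (r : ℤ)
    (q : ℝ) (hq0 : 0 < q) (hq1 : q < 1) :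
    (∑' j : ℤ,
      q ^ (((j * ((2 * (k : ℤ) + 3) * j + 2 * ℓ + 1) : ℤ) : ℝ) / 2) *
        (V q (r - ℓ - (2 * (k : ℤ) + 3) * j) - V q (r + ℓ + 1 + (2 * (k : ℤ) + 3) * j)))
    = qPInf q q * ∑' n : ℕ,
        (if (2 : ℤ) ∣ ((n : ℤ) - (r + ℓ)) then
          q ^ (((n : ℝ) ^ 2) / 2) * (qP q q n)⁻¹ *
            ∑' L : ℕ,
              q ^ ((2 * (L : ℝ) + (r : ℝ) - (ℓ : ℝ)) / 2) *
                ((qP q q L)⁻¹ * invQ q ((L : ℤ) + r)) *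
                ∑ i ∈ Finset.range (k + 1),
                  (if (2 : ℤ) ∣ ((i : ℤ) - r) then
                    Xcfg q⁻¹ 1 ((k : ℤ) + 2) 1 ((i : ℤ) + 1) (ℓ + 1) (n : ℤ) *
                      Xcfg q 1 ((k : ℤ) + 2) 1 ((i : ℤ) + 1) 1 (2 * (L : ℤ) + r)
                  else 0)
        else 0) := by
  have hP : (0 : ℤ) < (k : ℤ) + 2 := by omega
  have hG := GG_hasSum hq0 hq1 ((k : ℤ) + 2) (ℓ + 1) r ℓ hP
  simp_rw [rhs_term hq0 k r ℓ, lhs_term hq0 hq1 k r ℓ]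
  rw [tsum_reorder _ (Phi_summable hq0 hq1 _ _ _ _ hP), tsum_mul_left]
  congr 1
  rw [← hG.tsum_eq, ← (Equiv.prodComm ℤ ℤ).tsum_eq]
  have hs : Summable (fun x : ℤ × ℤ => GG q ((k : ℤ) + 2) (ℓ + 1) r ℓ (Equiv.prodComm ℤ ℤ x)) :=
    (Equiv.prodComm ℤ ℤ).summable_iff.mpr hG.summable
  rw [hs.tsum_prod]
  rfl
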